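/- Let f : ℝ^d → ℝ^d be piecewise affine, with f_j(x) = min_{a ∈ A_j} max_{b ∈ B_a} (⟨c_{a,b}, x⟩ + r_{a,b}) for finite nonempty index sets A_j and B_a, let u be a fixed point of f, and let D : ℝ^d → ℝ^d be the semidifferential of f at u, given coordinatewise by D_j(h) = min_{a ∈ Ā_j} max_{b ∈ B̄_a} ⟨c_{a,b}, h⟩ with Ā_j = {a ∈ A_j : f_j(u) = max_{b ∈ B_a} (⟨c_{a,b}, u⟩ + r_{a,b})} and B̄_a = {b ∈ B_a : ⟨c_{a,b}, u⟩ + r_{a,b} = max_{b' ∈ B_a} (⟨c_{a,b'}, u⟩ + r_{a,b'})}. If h ∈ ℝ^d_- is a nonzero vector with D(h) = h, then there exists t₀ > 0 such that for all t with 0 < t ≤ t₀, the vector u + t·h is a fixed point of f; in particular u + t·h is a fixed point of f strictly smaller than u. -/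

import Mathlib

open Filter Topology in
/-- The supremum of a finite family of germs `t ↦ p a + t * q a` at `0⁺` is the germ whose slope is
the supremum of the slopes over the maximizers of `p`. -/
theorem eventually_sSup_image_eq_add_mul {ι : Type*} {S : Set ι} (hS : S.Finite) (hne : S.Nonempty)
    {φ : ι → ℝ → ℝ} {p q : ι → ℝ} (hφ : ∀ a ∈ S, ∀ᶠ t in 𝓝[>] (0 : ℝ), φ a t = p a + t * q a) :
    ∀ᶠ t in 𝓝[>] (0 : ℝ), sSup ((fun a => φ a t) '' S) =
      sSup (p '' S) + t * sSup (q '' {a ∈ S | p a = sSup (p '' S)}) := by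
  have hM : IsGreatest (p '' S) (sSup (p '' S)) :=
    ⟨(hne.image p).csSup_mem (hS.image p), fun x hx => le_csSup (hS.image p).bddAbove hx⟩
  set M := sSup (p '' S)
  have hTfin : {a ∈ S | p a = M}.Finite := hS.subset fun a ha => ha.1
  have hTne : {a ∈ S | p a = M}.Nonempty := hM.1
  have hN : IsGreatest (q '' {a ∈ S | p a = M}) (sSup (q '' {a ∈ S | p a = M})) :=
    ⟨(hTne.image q).csSup_mem (hTfin.image q),
      fun x hx => le_csSup (hTfin.image q).bddAbove hx⟩
  set N := sSup (q '' {a ∈ S | p a = M})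
  obtain ⟨a₀, ⟨ha₀, hpa₀⟩, hqa₀⟩ := hN.1
  have hle : ∀ a ∈ S, ∀ᶠ t in 𝓝[>] (0 : ℝ), φ a t ≤ M + t * N := by
    intro a ha
    rcases (hM.2 ⟨a, ha, rfl⟩).lt_or_eq with hlt | heq
    · have hlim : ∀ x y : ℝ, Tendsto (fun t : ℝ => x + t * y) (𝓝[>] 0) (𝓝 x) := fun x y => by
        have hc : Continuous fun t : ℝ => x + t * y := by fun_prop
        simpa using (hc.tendsto 0).mono_left nhdsWithin_le_nhds
      filter_upwards [hφ a ha, (hlim (p a) (q a)).eventually_lt (hlim M N) hlt] with t h₁ h₂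
      exact h₁ ▸ h₂.le
    · filter_upwards [hφ a ha, self_mem_nhdsWithin] with t h₁ ht
      rw [h₁, heq]
      exact add_le_add_right (mul_le_mul_of_nonneg_left (hN.2 ⟨a, ⟨ha, heq⟩, rfl⟩) (le_of_lt ht)) _
  filter_upwards [hφ a₀ ha₀, (eventually_all_finite hS).2 hle] with t h₁ h₂
  refine IsGreatest.csSup_eq ⟨⟨a₀, ha₀, ?_⟩, ?_⟩
  · simp only [h₁, hpa₀, hqa₀]
  · rintro _ ⟨a, ha, rfl⟩
    exact h₂ a ha

theorem sInf_image_eq_neg_sSup_image_neg {ι : Type*} (g : ι → ℝ) (S : Set ι) :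
    sInf (g '' S) = -sSup ((fun a => -g a) '' S) := by
  rw [Real.sInf_def, ← Set.image_neg_eq_neg, Set.image_image]

open Filter Topology in
/-- The infimum of a finite family of germs `t ↦ p a + t * q a` at `0⁺` is the germ whose slope is
the infimum of the slopes over the minimizers of `p`. -/
theorem eventually_sInf_image_eq_add_mul {ι : Type*} {S : Set ι} (hS : S.Finite) (hne : S.Nonempty)
    {φ : ι → ℝ → ℝ} {p q : ι → ℝ} (hφ : ∀ a ∈ S, ∀ᶠ t in 𝓝[>] (0 : ℝ), φ a t = p a + t * q a) :
    ∀ᶠ t in 𝓝[>] (0 : ℝ), sInf ((fun a => φ a t) '' S) =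
      sInf (p '' S) + t * sInf (q '' {a ∈ S | sInf (p '' S) = p a}) := by
  have hneg : ∀ a ∈ S, ∀ᶠ t in 𝓝[>] (0 : ℝ), -φ a t = -p a + t * -q a := fun a ha =>
    (hφ a ha).mono fun t ht => by rw [ht]; ring
  filter_upwards [eventually_sSup_image_eq_add_mul (φ := fun a t => -φ a t) (p := fun a => -p a)
    (q := fun a => -q a) hS hne hneg] with t ht
  have hset : {a ∈ S | sInf (p '' S) = p a} =
      {a ∈ S | -p a = sSup ((fun a => -p a) '' S)} := by
    ext a
    rw [sInf_image_eq_neg_sSup_image_neg p]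
    exact and_congr_right fun _ => by rw [neg_eq_iff_eq_neg, eq_comm]
  rw [hset, sInf_image_eq_neg_sSup_image_neg, sInf_image_eq_neg_sSup_image_neg p,
    sInf_image_eq_neg_sSup_image_neg q, ht]
  ring


/-- Let `f` be piecewise affine, `u` a fixed point of `f`, and `D` the
semidifferential of `f` at `u` (given by the argmin/argmax formula). If `h ∈ ℝ^d_-` is a
nonzero vector with `D h = h`, then there exists `t₀ > 0` such that for all `0 < t ≤ t₀`,
`u + t • h` is a fixed point of `f`; in particular `u + t • h` is a fixed point of `f`
strictly smaller than `u`. -/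
theorem piecewise_affine_descent_direction
    {d : ℕ} {α β : Type*}
    (A : Fin d → Set α) (B : α → Set β)
    (hAfin : ∀ j, (A j).Finite) (hAne : ∀ j, (A j).Nonempty)
    (hBfin : ∀ a, (B a).Finite) (hBne : ∀ a, (B a).Nonempty)
    (c : α → β → Fin d → ℝ) (r : α → β → ℝ)
    (f : (Fin d → ℝ) → (Fin d → ℝ))
    (hf : ∀ x : Fin d → ℝ, ∀ j : Fin d, f x j =
      sInf ((fun a => sSup ((fun b => (∑ i, c a b i * x i) + r a b) '' B a)) '' A j))
    (u : Fin d → ℝ)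
    (hu : f u = u)
    (D : (Fin d → ℝ) → (Fin d → ℝ))
    (hD : ∀ h : Fin d → ℝ, ∀ j : Fin d, D h j =
      sInf ((fun a => sSup ((fun b => ∑ i, c a b i * h i) ''
          {b ∈ B a | (∑ i, c a b i * u i) + r a b =
            sSup ((fun b' => (∑ i, c a b' i * u i) + r a b') '' B a)})) ''
        {a ∈ A j | f u j =
          sSup ((fun b => (∑ i, c a b i * u i) + r a b) '' B a)}))
    (h : Fin d → ℝ) (hh_neg : h ≤ 0) (hh_ne : h ≠ 0) (hh_fix : D h = h) :
    ∃ t₀ : ℝ, 0 < t₀ ∧ ∀ t : ℝ, 0 < t → t ≤ t₀ →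
      f (u + t • h) = u + t • h ∧ u + t • h < u := by
  have key : ∀ j, ∀ᶠ t in nhdsWithin (0 : ℝ) (Set.Ioi 0),
      f (u + t • h) j = f u j + t * D h j := by
    intro j
    have hmax : ∀ a ∈ A j, ∀ᶠ t in nhdsWithin (0 : ℝ) (Set.Ioi 0),
        sSup ((fun b => (∑ i, c a b i * (u + t • h) i) + r a b) '' B a) =
          sSup ((fun b => (∑ i, c a b i * u i) + r a b) '' B a) +
            t * sSup ((fun b => ∑ i, c a b i * h i) ''
              {b ∈ B a | (∑ i, c a b i * u i) + r a b =
                sSup ((fun b' => (∑ i, c a b' i * u i) + r a b') '' B a)}) := fun a _ =>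
      eventually_sSup_image_eq_add_mul
        (φ := fun b t => (∑ i, c a b i * (u + t • h) i) + r a b) (hBfin a) (hBne a)
        fun b _ => Filter.Eventually.of_forall fun t => by
          simp only [Pi.add_apply, Pi.smul_apply, smul_eq_mul, mul_add, Finset.sum_add_distrib,
            Finset.mul_sum, mul_left_comm t]
          ring
    filter_upwards [eventually_sInf_image_eq_add_mul (hAfin j) (hAne j) hmax] with t ht
    rw [hD, hf, hf u, ht]
  obtain ⟨t₀, ht₀, hsub⟩ := mem_nhdsGT_iff_exists_Ioc_subset.1 (Filter.eventually_all.2 key)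
  refine ⟨t₀, ht₀, fun t ht htt => ⟨funext fun j => ?_, ?_⟩⟩
  · rw [hsub ⟨ht, htt⟩ j, hu, hh_fix]
    rfl
  · exact add_lt_of_neg_right u (smul_neg_of_pos_of_neg ht (lt_of_le_of_ne hh_neg hh_ne))
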